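/- arXiv:2004.09868 — 5 statements merged into one kernel-verified Lean document; each statement's English description precedes it below -/
import Mathlib

section
/- Let E be a real inner product space, D ⊆ E a convex set, g : E → ℝ and h : E → ℝ, and let x : ℕ → E be a sequence with x(t) ∈ D for all t. Suppose for every t there exists v(t) ∈ E with h(y) ≥ h(x(t)) + ⟨v(t), y − x(t)⟩ for all y ∈ D, and x(t+1) ∈ D satisfies g(y) + ⟨v(t), y⟩ ≤ g(x(t+1)) + ⟨v(t), x(t+1)⟩ for all y ∈ D. Then the sequence t ↦ g(x(t)) + h(x(t)) is monotone nondecreasing, and if moreover the function g + h is bounded above on D, this sequence of objective values converges to a finite limit. -/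
open RealInnerProductSpace Filter

/-- CCCP convergence: the sequence of objective values `g (x t) + h (x t)` generated by the
concave–convex procedure is monotone nondecreasing, and converges when `g + h` is
bounded above on the convex feasible set `D`. -/
theorem cccp_monotone_convergent
    {E : Type*} [NormedAddCommGroup E] [InnerProductSpace ℝ E]
    (D : Set E) (hD : Convex ℝ D) (g h : E → ℝ)
    (x : ℕ → E) (hxD : ∀ t, x t ∈ D)
    (v : ℕ → E)
    (hsub : ∀ t, ∀ y ∈ D, h y ≥ h (x t) + ⟪v t, y - x t⟫)
    (hmax : ∀ t, ∀ y ∈ D, g y + ⟪v t, y⟫ ≤ g (x (t + 1)) + ⟪v t, x (t + 1)⟫) :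
    Monotone (fun t => g (x t) + h (x t)) ∧
      ((∃ M : ℝ, ∀ y ∈ D, g y + h y ≤ M) →
        ∃ l : ℝ, Tendsto (fun t => g (x t) + h (x t)) atTop (nhds l)) := by
  have hmono : Monotone (fun t => g (x t) + h (x t)) := by
    refine monotone_nat_of_le_succ fun t => ?_
    have h1 := hsub t (x (t + 1)) (hxD (t + 1))
    have h2 := hmax t (x t) (hxD t)
    rw [inner_sub_right] at h1
    linarith
  refine ⟨hmono, ?_⟩
  rintro ⟨M, hM⟩
  refine ⟨_, tendsto_atTop_ciSup hmono ⟨M, ?_⟩⟩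
  rintro _ ⟨t, rfl⟩
  exact hM _ (hxD t)
end

section
/- Let E and F be real inner product spaces, 𝒫_U ⊆ E and 𝒫_D ⊆ F convex sets, and L_cav, L_vex : E × F → ℝ with L = L_cav + L_vex. Let u ∈ 𝒫_U and d ∈ 𝒫_D, and suppose: (i) there exists v_d ∈ F with L_vex(u, d'') ≥ L_vex(u, d) + ⟨v_d, d'' − d⟩ for all d'' ∈ 𝒫_D, and d' ∈ 𝒫_D satisfies L_cav(u, d'') + ⟨v_d, d''⟩ ≤ L_cav(u, d') + ⟨v_d, d'⟩ for all d'' ∈ 𝒫_D; (ii) there exists v_u ∈ E with L_vex(u'', d') ≥ L_vex(u, d') + ⟨v_u, u'' − u⟩ for all u'' ∈ 𝒫_U, and u' ∈ 𝒫_U satisfies L_cav(u'', d') + ⟨v_u, u''⟩ ≤ L_cav(u', d') + ⟨v_u, u'⟩ for all u'' ∈ 𝒫_U. Then L(u', d') ≥ L(u, d). -/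
open RealInnerProductSpace

/-- Sequential (block-coordinate) CCCP ascent over two blocks: one round consisting of a
downlink-block linearized maximization followed by an uplink-block linearized maximization
does not decrease the objective `L = L_cav + L_vex`. -/
theorem sequential_cccp_ascent
    {E F : Type*} [NormedAddCommGroup E] [InnerProductSpace ℝ E]
    [NormedAddCommGroup F] [InnerProductSpace ℝ F]
    (PU : Set E) (PD : Set F) (hPU : Convex ℝ PU) (hPD : Convex ℝ PD)
    (Lcav Lvex : E × F → ℝ)
    (L : E × F → ℝ) (hL : ∀ z, L z = Lcav z + Lvex z)
    (u : E) (hu : u ∈ PU) (d : F) (hd : d ∈ PD)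
    (d' : F) (hd' : d' ∈ PD)
    (vd : F)
    (hsubd : ∀ d'' ∈ PD, Lvex (u, d'') ≥ Lvex (u, d) + ⟪vd, d'' - d⟫)
    (hmaxd : ∀ d'' ∈ PD, Lcav (u, d'') + ⟪vd, d''⟫ ≤ Lcav (u, d') + ⟪vd, d'⟫)
    (u' : E) (hu' : u' ∈ PU)
    (vu : E)
    (hsubu : ∀ u'' ∈ PU, Lvex (u'', d') ≥ Lvex (u, d') + ⟪vu, u'' - u⟫)
    (hmaxu : ∀ u'' ∈ PU, Lcav (u'', d') + ⟪vu, u''⟫ ≤ Lcav (u', d') + ⟪vu, u'⟫) :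
    L (u', d') ≥ L (u, d) := by
  have h1 := hsubd d' hd'
  have h2 := hmaxd d hd
  have h3 := hsubu u' hu'
  have h4 := hmaxu u hu
  rw [inner_sub_right] at h1 h3
  rw [hL, hL]
  linarith
end

section
/- Let α be a type, E a real normed space, and V : α × E → ℝ bounded above on a set containing all iterates. Let (x(ℓ), p(ℓ)) for ℓ ∈ ℕ be a sequence, K(ℓ) ≥ 0 real numbers, and S(ℓ) sets of pairs such that for every ℓ ≥ 1: (x(ℓ−1), p(ℓ−1)) ∈ S(ℓ), (x(ℓ), p(ℓ)) ∈ S(ℓ), and V(x, p) − K(ℓ)·‖p − p(ℓ−1)‖² ≤ V(x(ℓ), p(ℓ)) − K(ℓ)·‖p(ℓ) − p(ℓ−1)‖² for all (x, p) ∈ S(ℓ). Then the sequence ℓ ↦ V(x(ℓ), p(ℓ)) is monotone nondecreasing and converges to a finite limit, and moreover the regularization terms vanish: K(ℓ)·‖p(ℓ) − p(ℓ−1)‖² → 0 as ℓ → ∞. -/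
open Filter

/-- Convergence of the regularized BCD iteration: if each step maximizes the utility minus
a quadratic regularization term over a feasible set containing the previous iterate, and the
utility is bounded above on the iterates, then the utility values form a monotone
nondecreasing convergent sequence and the regularization terms vanish. -/
theorem regularized_bcd_convergence
    {α : Type*} {E : Type*} [NormedAddCommGroup E] [NormedSpace ℝ E]
    (V : α × E → ℝ)
    (x : ℕ → α) (p : ℕ → E) (K : ℕ → ℝ) (hK : ∀ ℓ, 0 ≤ K ℓ)
    (S : ℕ → Set (α × E))
    (hprev : ∀ ℓ : ℕ, (x ℓ, p ℓ) ∈ S (ℓ + 1))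
    (hcur : ∀ ℓ : ℕ, (x (ℓ + 1), p (ℓ + 1)) ∈ S (ℓ + 1))
    (hmax : ∀ ℓ : ℕ, ∀ z ∈ S (ℓ + 1),
      V z - K (ℓ + 1) * ‖z.2 - p ℓ‖ ^ 2 ≤
        V (x (ℓ + 1), p (ℓ + 1)) - K (ℓ + 1) * ‖p (ℓ + 1) - p ℓ‖ ^ 2)
    (hbdd : ∃ M : ℝ, ∀ ℓ : ℕ, V (x ℓ, p ℓ) ≤ M) :
    Monotone (fun ℓ => V (x ℓ, p ℓ)) ∧
      (∃ l : ℝ, Tendsto (fun ℓ => V (x ℓ, p ℓ)) atTop (nhds l)) ∧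
      Tendsto (fun ℓ => K (ℓ + 1) * ‖p (ℓ + 1) - p ℓ‖ ^ 2) atTop (nhds 0) := by
  have hnn : ∀ ℓ, 0 ≤ K (ℓ + 1) * ‖p (ℓ + 1) - p ℓ‖ ^ 2 := fun ℓ =>
    mul_nonneg (hK _) (sq_nonneg _)
  have hstep : ∀ ℓ, K (ℓ + 1) * ‖p (ℓ + 1) - p ℓ‖ ^ 2 ≤
      V (x (ℓ + 1), p (ℓ + 1)) - V (x ℓ, p ℓ) := by
    intro ℓ
    have h := hmax ℓ _ (hprev ℓ)
    have h0 : K (ℓ + 1) * ‖p ℓ - p ℓ‖ ^ 2 = 0 := by simp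
    dsimp only at h
    linarith
  have hmono : Monotone (fun ℓ => V (x ℓ, p ℓ)) := by
    refine monotone_nat_of_le_succ fun ℓ => ?_
    have h1 := hnn ℓ
    have h2 := hstep ℓ
    linarith
  obtain ⟨M, hM⟩ := hbdd
  have hlim := tendsto_atTop_ciSup hmono ⟨M, by rintro _ ⟨ℓ, rfl⟩; exact hM ℓ⟩
  refine ⟨hmono, ⟨_, hlim⟩, ?_⟩
  have hd := ((tendsto_add_atTop_iff_nat 1).2 hlim).sub hlim
  rw [sub_self] at hd
  exact squeeze_zero hnn hstep hd
end

section
/- Let a ≥ 0 and b ≥ 0 be real numbers (the squared magnitudes |h_{k,k}|² and |h_{k',k'}|² of the direct channel gains of the strong and weak downlink users), let s > 0 (the noise power σ²), let P_k ≥ 0 (the strong user's power) and P_{k'} > 0 (the weak user's power), and let J be a finite index set with P_j ≥ 0, c_j ≥ 0, d_j ≥ 0 for each j ∈ J (the uplink powers and squared cross-gains |h_{j,k}|², |h_{j,k'}|²). Then a·P_{k'} / (a·P_k + Σ_{j∈J} c_j·P_j + s) ≥ b·P_{k'} / (b·P_k + Σ_{j∈J} d_j·P_j + s) if and only if Σ_{j∈J}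 (a·d_j − b·c_j)·P_j + s·(a − b) ≥ 0. -/
/-- Equivalence of the NOMA downlink SINR cancellation condition `γ_{k',k} ≥ γ_{k'}` with
the linear constraint `Σ_j (a d_j − b c_j) P_j + s (a − b) ≥ 0`, provided the weak
user's power is strictly positive. -/
theorem noma_sinr_linear_equiv
    {ι : Type*} (J : Finset ι)
    (a b s Pk Pk' : ℝ) (P c d : ι → ℝ)
    (ha : 0 ≤ a) (hb : 0 ≤ b) (hs : 0 < s)
    (hPk : 0 ≤ Pk) (hPk' : 0 < Pk')
    (hP : ∀ j ∈ J, 0 ≤ P j) (hc : ∀ j ∈ J, 0 ≤ c j) (hd : ∀ j ∈ J, 0 ≤ d j) :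
    a * Pk' / (a * Pk + ∑ j ∈ J, c j * P j + s) ≥
        b * Pk' / (b * Pk + ∑ j ∈ J, d j * P j + s) ↔
      ∑ j ∈ J, (a * d j - b * c j) * P j + s * (a - b) ≥ 0 := by
  have hC : 0 ≤ ∑ j ∈ J, c j * P j :=
    Finset.sum_nonneg fun j hj => mul_nonneg (hc j hj) (hP j hj)
  have hD : 0 ≤ ∑ j ∈ J, d j * P j :=
    Finset.sum_nonneg fun j hj => mul_nonneg (hd j hj) (hP j hj)
  have hsum : ∑ j ∈ J, (a * d j - b * c j) * P j
      = a * ∑ j ∈ J, d j * P j - b * ∑ j ∈ J, c j * P j := by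
    rw [Finset.mul_sum, Finset.mul_sum, ← Finset.sum_sub_distrib]
    exact Finset.sum_congr rfl fun j _ => by ring
  rw [hsum]
  generalize ∑ j ∈ J, c j * P j = C at *
  generalize ∑ j ∈ J, d j * P j = D at *
  have h1 : 0 < a * Pk + C + s := by positivity
  have h2 : 0 < b * Pk + D + s := by positivity
  rw [ge_iff_le, ge_iff_le, div_le_div_iff₀ h2 h1, ← sub_nonneg]
  have key : a * Pk' * (b * Pk + D + s) - b * Pk' * (a * Pk + C + s)
      = Pk' * (a * D - b * C + s * (a - b)) := by ring
  rw [key, mul_nonneg_iff_of_pos_left hPk']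
end

section
/- Let a ≥ 0 and b ≥ 0 be real numbers (the squared magnitudes |h_{k,k}|² and |h_{k',k'}|² of the direct channel gains of the strong and weak downlink users), let s > 0 (the noise power σ²), let P_k ≥ 0 (the strong user's power) and P_{k'} > 0 (the weak user's power), and let J be a finite index set with P_j ≥ 0, c_j ≥ 0, d_j ≥ 0 for each j ∈ J (the uplink powers and squared cross-gains |h_{j,k}|², |h_{j,k'}|²). Define γ₁ = a·P_{k'} / (a·P_k + Σ_{j∈J} c_j·P_j + s) and γ₂ = b·P_{k'} / (b·P_k + Σ_{j∈J} d_j·P_j + s). Then log(1 + γ₁)/log 2 ≥ log(1 + γ₂)/log 2 if and only if Σ_{j∈J} (a·d_j − b·c_j)·P_j + s·(a − b) ≥ 0. -/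
/-- Equivalence of the NOMA downlink rate cancellation condition
`log₂(1 + γ_{k',k}) ≥ log₂(1 + γ_{k'})` with the linear constraint
`Σ_j (a d_j − b c_j) P_j + s (a − b) ≥ 0`, provided the weak user's power is positive. -/
theorem noma_rate_linear_equiv
    {ι : Type*} (J : Finset ι)
    (a b s Pk Pk' : ℝ) (P c d : ι → ℝ)
    (ha : 0 ≤ a) (hb : 0 ≤ b) (hs : 0 < s)
    (hPk : 0 ≤ Pk) (hPk' : 0 < Pk')
    (hP : ∀ j ∈ J, 0 ≤ P j) (hc : ∀ j ∈ J, 0 ≤ c j) (hd : ∀ j ∈ J, 0 ≤ d j)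
    (γ₁ γ₂ : ℝ)
    (hγ₁ : γ₁ = a * Pk' / (a * Pk + ∑ j ∈ J, c j * P j + s))
    (hγ₂ : γ₂ = b * Pk' / (b * Pk + ∑ j ∈ J, d j * P j + s)) :
    Real.log (1 + γ₁) / Real.log 2 ≥ Real.log (1 + γ₂) / Real.log 2 ↔
      ∑ j ∈ J, (a * d j - b * c j) * P j + s * (a - b) ≥ 0 := by
  have hC : 0 ≤ ∑ j ∈ J, c j * P j :=
    Finset.sum_nonneg fun j hj => mul_nonneg (hc j hj) (hP j hj)
  have hD : 0 ≤ ∑ j ∈ J, d j * P j :=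
    Finset.sum_nonneg fun j hj => mul_nonneg (hd j hj) (hP j hj)
  have hsum : ∑ j ∈ J, (a * d j - b * c j) * P j
      = a * ∑ j ∈ J, d j * P j - b * ∑ j ∈ J, c j * P j := by
    rw [Finset.mul_sum, Finset.mul_sum, ← Finset.sum_sub_distrib]
    exact Finset.sum_congr rfl fun j _ => by ring
  rw [hsum]
  generalize ∑ j ∈ J, c j * P j = C at *
  generalize ∑ j ∈ J, d j * P j = D at *
  have h1 : 0 < a * Pk + C + s := by positivity
  have h2 : 0 < b * Pk + D + s := by positivity
  have g1 : 0 ≤ γ₁ := by rw [hγ₁]; positivity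
  have g2 : 0 ≤ γ₂ := by rw [hγ₂]; positivity
  have hl : 0 < Real.log 2 := Real.log_pos (by norm_num)
  rw [ge_iff_le, div_le_div_iff_of_pos_right hl,
    Real.log_le_log_iff (by linarith) (by linarith), add_le_add_iff_left, hγ₁, hγ₂,
    div_le_div_iff₀ h2 h1, ← sub_nonneg]
  have key : a * Pk' * (b * Pk + D + s) - b * Pk' * (a * Pk + C + s)
      = Pk' * (a * D - b * C + s * (a - b)) := by ring
  rw [key, mul_nonneg_iff_of_pos_left hPk']
end
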